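/- The quadratic algebra A^(p) = K⟨x^1,...,x^{2p+1}⟩/[∂_i α^(p)] is isomorphic to the tensor product B^(p) ⊗ K[x^{2p+1}], where B^(p) = K⟨x^1,...,x^{2p}⟩/[Σ_{r=1}^p (x^r ⊗ x^{r+p} − x^{r+p} ⊗ x^r)]; in particular x^{2p+1} is central in A^(p). -/

import Mathlib

/-- The exterior 3-form `α⁽ᵖ⁾ = Σ_{m=1}^p θ^m ∧ θ^{m+p} ∧ θ^{2p+1}` on `K^{2p+1}`. -/
def wP (K : Type*) [Field K] (p : ℕ) (X Y Z : Fin (2 * p + 1) → K) : K :=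
  ∑ m : Fin p,
    Matrix.det
      !![X ⟨m.1, by have := m.2; omega⟩, X ⟨m.1 + p, by have := m.2; omega⟩, X ⟨2 * p, by omega⟩;
         Y ⟨m.1, by have := m.2; omega⟩, Y ⟨m.1 + p, by have := m.2; omega⟩, Y ⟨2 * p, by omega⟩;
         Z ⟨m.1, by have := m.2; omega⟩, Z ⟨m.1 + p, by have := m.2; omega⟩, Z ⟨2 * p, by omega⟩]

/-- The relations `∂_i α⁽ᵖ⁾ = Σ_{j,k} α⁽ᵖ⁾_{ijk} x^j ⊗ x^k` of the quadratic algebra `A⁽ᵖ⁾`. -/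
inductive relA (K : Type*) [Field K] (p : ℕ) :
    FreeAlgebra K (Fin (2 * p + 1)) → FreeAlgebra K (Fin (2 * p + 1)) → Prop
  | mk (i : Fin (2 * p + 1)) :
      relA K p
        (∑ j, ∑ k, wP K p (Pi.single i 1) (Pi.single j 1) (Pi.single k 1) •
          (FreeAlgebra.ι K j * FreeAlgebra.ι K k)) 0

/-- The relation `Σ_{r=1}^p (x^r ⊗ x^{r+p} - x^{r+p} ⊗ x^r)` defining `B⁽ᵖ⁾`. -/
inductive relB (K : Type*) [Field K] (p : ℕ) :
    FreeAlgebra K (Fin (2 * p)) → FreeAlgebra K (Fin (2 * p)) → Prop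
  | mk : relB K p
      (∑ r : Fin p,
        (FreeAlgebra.ι K ⟨r.1, by have := r.2; omega⟩ *
            FreeAlgebra.ι K ⟨r.1 + p, by have := r.2; omega⟩ -
          FreeAlgebra.ι K ⟨r.1 + p, by have := r.2; omega⟩ *
            FreeAlgebra.ι K ⟨r.1, by have := r.2; omega⟩)) 0

open scoped TensorProduct

section Relations

variable {K : Type*} [Field K] {p : ℕ} {S : Type*} [Ring S] [Algebra K S]

theorem sum_single_mul_single_smul {n : ℕ} (f : Fin n → S) (c : K) (a b : Fin n) :
    ∑ j, ∑ k, (c * (Pi.single j 1 : Fin n → K) a * (Pi.single k 1 : Fin n → K) b) • (f j * f k) =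
      c • (f a * f b) := by
  simp [Pi.single_apply]

theorem wP_eq_sum (X Y Z : Fin (2 * p + 1) → K) :
    wP K p X Y Z = ∑ m : Fin p,
      (X ⟨m.1, by omega⟩ * Y ⟨m.1 + p, by omega⟩ * Z ⟨2 * p, by omega⟩ -
        X ⟨m.1, by omega⟩ * Y ⟨2 * p, by omega⟩ * Z ⟨m.1 + p, by omega⟩ -
        (X ⟨m.1 + p, by omega⟩ * Y ⟨m.1, by omega⟩ * Z ⟨2 * p, by omega⟩ -
          X ⟨m.1 + p, by omega⟩ * Y ⟨2 * p, by omega⟩ * Z ⟨m.1, by omega⟩) +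
        (X ⟨2 * p, by omega⟩ * Y ⟨m.1, by omega⟩ * Z ⟨m.1 + p, by omega⟩ -
          X ⟨2 * p, by omega⟩ * Y ⟨m.1 + p, by omega⟩ * Z ⟨m.1, by omega⟩)) := by
  refine Finset.sum_congr rfl fun m _ => ?_
  simp [Matrix.det_fin_three]
  ring

/-- The relation `∂_i α⁽ᵖ⁾` evaluated at a tuple `f` of elements of an algebra. -/
theorem sum_wP_smul (f : Fin (2 * p + 1) → S) (i : Fin (2 * p + 1)) :
    ∑ j, ∑ k, wP K p (Pi.single i 1) (Pi.single j 1) (Pi.single k 1) • (f j * f k) =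
      ∑ m : Fin p,
        ((Pi.single i 1 : Fin (2 * p + 1) → K) ⟨m.1, by omega⟩ •
            (f ⟨m.1 + p, by omega⟩ * f ⟨2 * p, by omega⟩ -
              f ⟨2 * p, by omega⟩ * f ⟨m.1 + p, by omega⟩) -
          (Pi.single i 1 : Fin (2 * p + 1) → K) ⟨m.1 + p, by omega⟩ •
            (f ⟨m.1, by omega⟩ * f ⟨2 * p, by omega⟩ -
              f ⟨2 * p, by omega⟩ * f ⟨m.1, by omega⟩) +
          (Pi.single i 1 : Fin (2 * p + 1) → K) ⟨2 * p, by omega⟩ •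
            (f ⟨m.1, by omega⟩ * f ⟨m.1 + p, by omega⟩ -
              f ⟨m.1 + p, by omega⟩ * f ⟨m.1, by omega⟩)) := by
  simp only [wP_eq_sum, Finset.sum_smul]
  rw [Finset.sum_congr rfl fun j _ => Finset.sum_comm, Finset.sum_comm]
  refine Finset.sum_congr rfl fun m _ => ?_
  simp only [sub_smul, add_smul, Finset.sum_sub_distrib, Finset.sum_add_distrib,
    sum_single_mul_single_smul, smul_sub]

theorem sum_wP_smul_eq_zero (f : Fin (2 * p + 1) → S)
    (hc : ∀ i, Commute (f ⟨2 * p, by omega⟩) (f i))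
    (hs : ∑ m : Fin p, (f ⟨m.1, by omega⟩ * f ⟨m.1 + p, by omega⟩ -
      f ⟨m.1 + p, by omega⟩ * f ⟨m.1, by omega⟩) = 0) (i : Fin (2 * p + 1)) :
    ∑ j, ∑ k, wP K p (Pi.single i 1) (Pi.single j 1) (Pi.single k 1) • (f j * f k) = 0 := by
  rw [sum_wP_smul]
  simp only [(hc _).eq, sub_self, smul_zero, zero_add]
  rw [← Finset.smul_sum, hs, smul_zero]

theorem commute_of_sum_wP_smul_eq_zero (f : Fin (2 * p + 1) → S)
    (h : ∀ i, ∑ j, ∑ k, wP K p (Pi.single i 1) (Pi.single j 1) (Pi.single k 1) •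
      (f j * f k) = 0) (i : Fin (2 * p + 1)) :
    Commute (f ⟨2 * p, by omega⟩) (f i) := by
  obtain ⟨i, hi⟩ := i
  rcases lt_or_ge i p with hip | hip
  · have := h ⟨i + p, by omega⟩
    rw [sum_wP_smul, Finset.sum_eq_single ⟨i, hip⟩] at this
    · have h1 : p ≠ 0 := by omega
      have h2 : 2 * p ≠ i + p := by omega
      simpa [Pi.single_apply, h1, h2, sub_eq_zero, Commute, SemiconjBy] using this
    · intro m _ hm
      have h0 : m.1 ≠ i := fun h => hm (Fin.ext h)
      have h1 : m.1 ≠ i + p := by omega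
      have h2 : 2 * p ≠ i + p := by omega
      simp [h0, h1, h2]
    · simp
  rcases lt_or_ge i (2 * p) with hip' | hip'
  · obtain ⟨m, rfl⟩ : ∃ m, i = m + p := ⟨i - p, by omega⟩
    have := h ⟨m, by omega⟩
    rw [sum_wP_smul, Finset.sum_eq_single ⟨m, by omega⟩] at this
    · have h1 : p ≠ 0 := by omega
      have h2 : 2 * p ≠ m := by omega
      simpa [Pi.single_apply, h1, h2, sub_eq_zero, Commute, SemiconjBy,
        eq_comm (a := f ⟨2 * p, _⟩ * _)] using this
    · intro r _ hr
      have h0 : r.1 ≠ m := fun h => hr (Fin.ext h)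
      have h1 : r.1 + p ≠ m := by omega
      have h2 : 2 * p ≠ m := by omega
      simp [h0, h1, h2]
    · simp
  · obtain rfl : i = 2 * p := by omega
    exact Commute.refl _

theorem sum_commutator_of_sum_wP_smul_eq_zero (f : Fin (2 * p + 1) → S)
    (h : ∑ j, ∑ k, wP K p (Pi.single ⟨2 * p, by omega⟩ 1) (Pi.single j 1) (Pi.single k 1) •
      (f j * f k) = 0) :
    ∑ m : Fin p, (f ⟨m.1, by omega⟩ * f ⟨m.1 + p, by omega⟩ -
      f ⟨m.1 + p, by omega⟩ * f ⟨m.1, by omega⟩) = 0 := by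
  rw [sum_wP_smul] at h
  rw [← h]
  refine Finset.sum_congr rfl fun m _ => ?_
  have h1 : m.1 ≠ 2 * p := by omega
  have h2 : m.1 + p ≠ 2 * p := by omega
  simp [h1, h2]

end Relations

section Algebras

variable (K : Type*) [Field K] (p : ℕ)

/-- The generator `x^{i+1}` of `A⁽ᵖ⁾`. -/
def genA (i : Fin (2 * p + 1)) : RingQuot (relA K p) :=
  RingQuot.mkAlgHom K (relA K p) (FreeAlgebra.ι K i)

/-- The generator `x^{i+1}` of `B⁽ᵖ⁾`. -/
def genB (i : Fin (2 * p)) : RingQuot (relB K p) :=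
  RingQuot.mkAlgHom K (relB K p) (FreeAlgebra.ι K i)

theorem sum_wP_smul_genA (i : Fin (2 * p + 1)) :
    ∑ j, ∑ k, wP K p (Pi.single i 1) (Pi.single j 1) (Pi.single k 1) •
      (genA K p j * genA K p k) = 0 := by
  simpa [genA] using RingQuot.mkAlgHom_rel K (relA.mk (K := K) (p := p) i)

theorem sum_commutator_genB :
    ∑ r : Fin p, (genB K p ⟨r.1, by omega⟩ * genB K p ⟨r.1 + p, by omega⟩ -
      genB K p ⟨r.1 + p, by omega⟩ * genB K p ⟨r.1, by omega⟩) = 0 := by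
  simpa [genB] using RingQuot.mkAlgHom_rel K (relB.mk (K := K) (p := p))

theorem commute_genA_last (a : RingQuot (relA K p)) :
    Commute (genA K p ⟨2 * p, by omega⟩) a := by
  obtain ⟨a, rfl⟩ := RingQuot.mkAlgHom_surjective K (relA K p) a
  induction a using FreeAlgebra.induction with
  | grade0 r => rw [AlgHom.commutes]; exact Algebra.commute_algebraMap_right r _
  | grade1 i => exact commute_of_sum_wP_smul_eq_zero _ (sum_wP_smul_genA K p) i
  | mul a b ha hb => rw [map_mul]; exact ha.mul_right hb
  | add a b ha hb => rw [map_add]; exact ha.add_right hb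

/-- The images in `B⁽ᵖ⁾ ⊗ K[X]` of the generators of `A⁽ᵖ⁾`. -/
noncomputable def genTensor (i : Fin (2 * p + 1)) : RingQuot (relB K p) ⊗[K] Polynomial K :=
  if h : i.1 < 2 * p then genB K p ⟨i.1, h⟩ ⊗ₜ 1 else 1 ⊗ₜ Polynomial.X

theorem genTensor_of_lt (i : ℕ) (h : i < 2 * p) :
    genTensor K p ⟨i, by omega⟩ = genB K p ⟨i, h⟩ ⊗ₜ 1 := dif_pos h

theorem genTensor_last : genTensor K p ⟨2 * p, by omega⟩ = 1 ⊗ₜ Polynomial.X :=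
  dif_neg (lt_irrefl _)

theorem commute_genTensor_last (i : Fin (2 * p + 1)) :
    Commute (genTensor K p ⟨2 * p, by omega⟩) (genTensor K p i) := by
  rw [genTensor_last, genTensor]
  split_ifs
  · simp [Commute, SemiconjBy]
  · exact Commute.refl _

theorem sum_commutator_genTensor :
    ∑ m : Fin p, (genTensor K p ⟨m.1, by omega⟩ * genTensor K p ⟨m.1 + p, by omega⟩ -
      genTensor K p ⟨m.1 + p, by omega⟩ * genTensor K p ⟨m.1, by omega⟩) = 0 := by
  have h := congrArg (Algebra.TensorProduct.includeLeft : _ →ₐ[K] _ ⊗[K] Polynomial K)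
    (sum_commutator_genB K p)
  rw [map_zero, map_sum] at h
  rw [← h]
  refine Finset.sum_congr rfl fun m _ => ?_
  rw [genTensor_of_lt K p m.1 (by omega), genTensor_of_lt K p (m.1 + p) (by omega)]
  simp [TensorProduct.sub_tmul]

/-- The homomorphism `A⁽ᵖ⁾ → B⁽ᵖ⁾ ⊗ K[X]`. -/
noncomputable def toTensor :
    RingQuot (relA K p) →ₐ[K] RingQuot (relB K p) ⊗[K] Polynomial K :=
  RingQuot.liftAlgHom K ⟨FreeAlgebra.lift K (genTensor K p), by
    rintro _ _ ⟨i⟩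
    simp only [map_sum, map_smul, map_mul, map_zero, FreeAlgebra.lift_ι_apply]
    exact sum_wP_smul_eq_zero (genTensor K p) (commute_genTensor_last K p) (sum_commutator_genTensor K p) i⟩

theorem toTensor_genA (i : Fin (2 * p + 1)) : toTensor K p (genA K p i) = genTensor K p i := by
  simp [toTensor, genA]

/-- The homomorphism `B⁽ᵖ⁾ → A⁽ᵖ⁾` preserving the generators. -/
noncomputable def homBA : RingQuot (relB K p) →ₐ[K] RingQuot (relA K p) :=
  RingQuot.liftAlgHom K ⟨FreeAlgebra.lift K fun i => genA K p ⟨i.1, by omega⟩, by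
    rintro _ _ ⟨⟩
    simpa using sum_commutator_of_sum_wP_smul_eq_zero _ (sum_wP_smul_genA K p _)⟩

theorem homBA_genB (i : Fin (2 * p)) : homBA K p (genB K p i) = genA K p ⟨i.1, by omega⟩ := by
  simp [homBA, genB]

/-- The homomorphism `B⁽ᵖ⁾ ⊗ K[X] → A⁽ᵖ⁾`. -/
noncomputable def ofTensor :
    RingQuot (relB K p) ⊗[K] Polynomial K →ₐ[K] RingQuot (relA K p) :=
  Algebra.TensorProduct.lift (homBA K p) (Polynomial.aeval (genA K p ⟨2 * p, by omega⟩))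
    fun b q => by
      induction q using Polynomial.induction_on' with
      | add q r hq hr => rw [map_add]; exact hq.add_right hr
      | monomial n c =>
        rw [Polynomial.aeval_monomial]
        exact (Algebra.commute_algebraMap_right c _).mul_right
          ((commute_genA_last K p _).symm.pow_right n)

theorem ofTensor_genTensor (i : Fin (2 * p + 1)) :
    ofTensor K p (genTensor K p i) = genA K p i := by
  obtain ⟨i, hi⟩ := i
  rcases lt_or_ge i (2 * p) with h | h
  · rw [genTensor_of_lt K p i h]
    simp [ofTensor, homBA_genB]
  · obtain rfl : i = 2 * p := by omega
    rw [genTensor_last]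
    simp [ofTensor]

/-- The isomorphism `A⁽ᵖ⁾ ≃ B⁽ᵖ⁾ ⊗ K[X]`. -/
noncomputable def equivTensor :
    RingQuot (relA K p) ≃ₐ[K] RingQuot (relB K p) ⊗[K] Polynomial K :=
  AlgEquiv.ofAlgHom (toTensor K p) (ofTensor K p)
    (by
      refine Algebra.TensorProduct.ext ?_ ?_
      · refine RingQuot.ringQuot_ext' K _ _ (FreeAlgebra.hom_ext (funext fun i => ?_))
        change toTensor K p (ofTensor K p (genB K p i ⊗ₜ 1)) = genB K p i ⊗ₜ 1
        rw [← genTensor_of_lt K p i i.2, ofTensor_genTensor, toTensor_genA]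
      · refine Polynomial.algHom_ext ?_
        change toTensor K p (ofTensor K p (1 ⊗ₜ Polynomial.X)) = 1 ⊗ₜ Polynomial.X
        rw [← genTensor_last, ofTensor_genTensor, toTensor_genA])
    (by
      refine RingQuot.ringQuot_ext' K _ _ (FreeAlgebra.hom_ext (funext fun i => ?_))
      change ofTensor K p (toTensor K p (genA K p i)) = genA K p i
      rw [toTensor_genA, ofTensor_genTensor])

end Algebras

/-- `A⁽ᵖ⁾ ≅ B⁽ᵖ⁾ ⊗ K[x^{2p+1}]` as `K`-algebras, the isomorphism sending the generators
`x^1, …, x^{2p}` to the corresponding generators of `B⁽ᵖ⁾` and `x^{2p+1}` to the polynomial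
variable; in particular `x^{2p+1}` is central in `A⁽ᵖ⁾`. -/
theorem stmt_9 {K : Type*} [Field K] (p : ℕ) (hp : 1 ≤ p) :
    (∃ φ : RingQuot (relA K p) ≃ₐ[K] TensorProduct K (RingQuot (relB K p)) (Polynomial K),
      (∀ i : Fin (2 * p),
        φ (RingQuot.mkAlgHom K (relA K p) (FreeAlgebra.ι K ⟨i.1, by have := i.2; omega⟩)) =
          (RingQuot.mkAlgHom K (relB K p) (FreeAlgebra.ι K i)) ⊗ₜ[K] 1) ∧
      φ (RingQuot.mkAlgHom K (relA K p) (FreeAlgebra.ι K ⟨2 * p, by omega⟩)) =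
        1 ⊗ₜ[K] Polynomial.X) ∧
    ∀ a : RingQuot (relA K p),
      Commute (RingQuot.mkAlgHom K (relA K p) (FreeAlgebra.ι K ⟨2 * p, by omega⟩)) a := by
  refine ⟨⟨equivTensor K p, fun i => ?_, ?_⟩, commute_genA_last K p⟩
  · exact (toTensor_genA K p _).trans (genTensor_of_lt K p i i.2)
  · exact (toTensor_genA K p _).trans (genTensor_last K p)
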